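/- arXiv:2604.04282 — 2 statements merged into one kernel-verified Lean document; each statement's English description precedes it below -/
import Mathlib

section
/- Let 𝓡 be a finite set of rectangles, 𝓗 a finite set of horizontal lines, 𝓥 a finite set of vertical lines, and k a natural number. Suppose 𝓗₁ ⊆ 𝓗 and 𝓥₀ ⊆ 𝓥 are such that 𝓗₁ ∪ 𝓥₀ stabs 𝓡; suppose Γ_v ⊆ Γ(𝓥₀) and 𝓥₁ ⊆ 𝓥₀ are such that Γ_v is separated by 𝓥₁; suppose 𝓗* ⊆ 𝓗 with |𝓗*| ≤ k, and for each P ∈ Γ_v a vertical line v*_P ⊆ P is given, such that 𝓡 is stabbed by 𝓗₁ ∪ 𝓥₁ ∪ 𝓗* ∪ {v*_P : P ∈ Γ_v}. Then there exist 𝓚 ⊆ 𝓡 and 𝓗₀ ⊆ 𝓗 satisfying: (i) |𝓗₀| ≤ 2·|Γ_v|·(2k+1) + |𝓗*|; (ii) for every 𝓐 ⊆ 𝓗 with |𝓐| ≤ 2k and every Γ_v-structured 𝓑 ⊆ 𝓥, the set 𝓡 is stabbed by 𝓗₁ ∪ 𝓥₁ ∪ 𝓐 ∪ 𝓑 if and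 only if 𝓚 is stabbed by 𝓗₁ ∪ 𝓥₁ ∪ 𝓐 ∪ 𝓑; and (iii) every rectangle R ∈ 𝓚 that is stabbed by 𝓗 is also stabbed by 𝓗₁ ∪ 𝓥₁ ∪ 𝓗₀. -/
open Set MeasureTheory

noncomputable section

/-- The horizontal line at height `y`. -/
def hline (y : ℝ) : Set (ℝ × ℝ) := {p : ℝ × ℝ | p.2 = y}

/-- The vertical line at abscissa `x`. -/
def vline (x : ℝ) : Set (ℝ × ℝ) := {p : ℝ × ℝ | p.1 = x}

/-- The axis-parallel rectangle `[a,b] × [c,d]`. -/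
def rect (a b c d : ℝ) : Set (ℝ × ℝ) := Set.Icc a b ×ˢ Set.Icc c d

/-- A set is a (possibly degenerate) axis-parallel rectangle. -/
def IsRect (R : Set (ℝ × ℝ)) : Prop :=
  ∃ a b c d : ℝ, a ≤ b ∧ c ≤ d ∧ R = rect a b c d

/-- A line `l` stabs a rectangle `R` if they intersect. -/
def Stabs (l R : Set (ℝ × ℝ)) : Prop := (R ∩ l).Nonempty

/-- A rectangle is stabbed by a set of lines if some line of the set stabs it. -/
def StabbedBy (L : Set (Set (ℝ × ℝ))) (R : Set (ℝ × ℝ)) : Prop :=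
  ∃ l ∈ L, Stabs l R

/-- A set of lines stabs a set of rectangles if every rectangle is stabbed. -/
def StabsAll (L Rs : Set (Set (ℝ × ℝ))) : Prop := ∀ R ∈ Rs, StabbedBy L R

/-- All members are horizontal lines. -/
def IsHLineSet (H : Set (Set (ℝ × ℝ))) : Prop := ∀ l ∈ H, ∃ y : ℝ, l = hline y

/-- All members are vertical lines. -/
def IsVLineSet (V : Set (Set (ℝ × ℝ))) : Prop := ∀ l ∈ V, ∃ x : ℝ, l = vline x

/-- `H'` is nicely positioned w.r.t. `H''`: for each line of `H'` at height `y`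
there is a line of `H''` in the strip `ℝ × (y⁻, y]`, where `y⁻` is the largest
height of a line of `H'` below `y` (or `-∞`). -/
def NicelyPositioned (H' H'' : Set (Set (ℝ × ℝ))) : Prop :=
  ∀ y : ℝ, hline y ∈ H' →
    ∃ z : ℝ, hline z ∈ H'' ∧ z ≤ y ∧ ∀ y' : ℝ, hline y' ∈ H' → y' < y → y' < z

/-- The open vertical strip `(a, b) × ℝ`. -/
def vstrip (a b : ℝ) : Set (ℝ × ℝ) := {p : ℝ × ℝ | a < p.1 ∧ p.1 < b}

/-- The open horizontal strip `ℝ × (a, b)`. -/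
def hstrip (a b : ℝ) : Set (ℝ × ℝ) := {p : ℝ × ℝ | a < p.2 ∧ p.2 < b}

def IsVStrip (P : Set (ℝ × ℝ)) : Prop := ∃ a b : ℝ, a < b ∧ P = vstrip a b

def IsHStrip (P : Set (ℝ × ℝ)) : Prop := ∃ a b : ℝ, a < b ∧ P = hstrip a b

/-- The vertical line `l` separates `P` and `P'` (they lie on opposite sides). -/
def SepByVLine (P P' l : Set (ℝ × ℝ)) : Prop :=
  ∃ x : ℝ, l = vline x ∧
    (((∀ p ∈ P, p.1 < x) ∧ (∀ p ∈ P', x < p.1)) ∨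
     ((∀ p ∈ P', p.1 < x) ∧ (∀ p ∈ P, x < p.1)))

/-- The horizontal line `l` separates `P` and `P'`. -/
def SepByHLine (P P' l : Set (ℝ × ℝ)) : Prop :=
  ∃ y : ℝ, l = hline y ∧
    (((∀ p ∈ P, p.2 < y) ∧ (∀ p ∈ P', y < p.2)) ∨
     ((∀ p ∈ P', p.2 < y) ∧ (∀ p ∈ P, y < p.2)))

/-- A family of vertical strips is separated by a set of vertical lines. -/
def VSeparated (Gam L : Set (Set (ℝ × ℝ))) : Prop :=
  (∀ P ∈ Gam, ∀ P' ∈ Gam, P ≠ P' → ∃ l ∈ L, SepByVLine P P' l) ∧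
  (∀ P ∈ Gam, ∀ l ∈ L, P ∩ l = ∅)

/-- A family of horizontal strips is separated by a set of horizontal lines. -/
def HSeparated (Gam L : Set (Set (ℝ × ℝ))) : Prop :=
  (∀ P ∈ Gam, ∀ P' ∈ Gam, P ≠ P' → ∃ l ∈ L, SepByHLine P P' l) ∧
  (∀ P ∈ Gam, ∀ l ∈ L, P ∩ l = ∅)

/-- `Γ(L)`: the connected components of the complement of the union of the lines of `L`. -/
def components (L : Set (Set (ℝ × ℝ))) : Set (Set (ℝ × ℝ)) :=
  {P | ∃ p ∈ (⋃ l ∈ L, l)ᶜ, P = connectedComponentIn ((⋃ l ∈ L, l)ᶜ) p}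

/-- `B` is `Γ`-structured: a bijection `f : B → Γ` with `l ⊆ f l`. -/
def Structured (B Gam : Set (Set (ℝ × ℝ))) : Prop :=
  ∃ f : Set (ℝ × ℝ) → Set (ℝ × ℝ), Set.BijOn f B Gam ∧ ∀ l ∈ B, l ⊆ f l

lemma StabbedBy.mono' {L L' : Set (Set (ℝ × ℝ))} (h : L ⊆ L') {r : Set (ℝ × ℝ)}
    (hr : StabbedBy L r) : StabbedBy L' r := by
  obtain ⟨l, hl, hs⟩ := hr
  exact ⟨l, h hl, hs⟩

lemma stabbedBy_union {L L' : Set (Set (ℝ × ℝ))} {r : Set (ℝ × ℝ)} :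
    StabbedBy (L ∪ L') r ↔ StabbedBy L r ∨ StabbedBy L' r := by
  constructor
  · rintro ⟨l, hl | hl, hs⟩
    · exact Or.inl ⟨l, hl, hs⟩
    · exact Or.inr ⟨l, hl, hs⟩
  · rintro (h | h)
    · exact h.mono' subset_union_left
    · exact h.mono' subset_union_right

lemma stabs_vline_rect {a b c d x : ℝ} (hcd : c ≤ d) :
    Stabs (vline x) (rect a b c d) ↔ a ≤ x ∧ x ≤ b := by
  constructor
  · rintro ⟨p, hp, hx⟩
    simp only [vline, mem_setOf_eq] at hx
    subst hx
    exact hp.1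
  · intro h
    exact ⟨(x, c), ⟨h, ⟨le_refl _, hcd⟩⟩, rfl⟩

lemma prefix_lemma (S H : Set (Set (ℝ × ℝ))) (hS : S.Finite) (hH : H.Finite)
    (b : Set (ℝ × ℝ) → ℝ) (m : ℕ) :
    ∃ K ⊆ S, ∃ H₀ ⊆ H, H₀.ncard ≤ m + 1 ∧ (∀ r ∈ K, StabbedBy H r → StabbedBy H₀ r) ∧
      ∀ A ⊆ H, A.ncard ≤ m → ∀ T : Set (ℝ × ℝ) → Prop,
        (∀ r ∈ S, ∀ s ∈ S, b r ≤ b s → T r → T s) →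
        (∀ r ∈ K, StabbedBy A r ∨ T r) → ∀ r ∈ S, StabbedBy A r ∨ T r := by
  classical
  by_cases hst : ∃ A ⊆ H, A.ncard ≤ m ∧ StabsAll A S
  · obtain ⟨A, hA, hm, hs⟩ := hst
    exact ⟨S, subset_rfl, A, hA, by omega, fun r hr _ => hs r hr, fun _ _ _ _ _ h => h⟩
  have hex : ∃ n : ℕ, ∃ K ⊆ S, (∀ r ∈ K, ∀ s ∈ S, s ∉ K → b r ≤ b s) ∧
      (¬ ∃ A ⊆ H, A.ncard ≤ m ∧ StabsAll A K) ∧ K.ncard = n :=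
    ⟨_, S, subset_rfl, fun r _ s hs hn => absurd hs hn, hst, rfl⟩
  obtain ⟨K, hKS, hpre, hun, hcard⟩ := Nat.find_spec hex
  have hmin := fun n (h : n < Nat.find hex) => Nat.find_min hex h
  have hKfin := hS.subset hKS
  have hne : K.Nonempty := by
    by_contra hne
    rw [not_nonempty_iff_eq_empty] at hne
    subst hne
    exact hun ⟨∅, empty_subset _, by simp, fun r hr => hr.elim⟩
  obtain ⟨q, hq, hqm⟩ := Set.exists_max_image K b hKfin hne
  have hlt : (K \ {q}).ncard < Nat.find hex := by
    rw [← hcard]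
    exact Set.ncard_diff_singleton_lt_of_mem hq hKfin
  have h1 := hmin _ hlt
  have h2 : ∃ A ⊆ H, A.ncard ≤ m ∧ StabsAll A (K \ {q}) := by
    by_contra hc
    refine h1 ⟨K \ {q}, diff_subset.trans hKS, ?_, hc, rfl⟩
    intro r hr s hs hsn
    by_cases hsK : s ∈ K
    · have : s = q := by
        by_contra hsq
        exact hsn ⟨hsK, hsq⟩
      subst this
      exact hqm r hr.1
    · exact hpre r hr.1 s hs hsK
  obtain ⟨A₀, hA₀, hA₀m, hA₀s⟩ := h2
  have hfinal : ∀ A ⊆ H, A.ncard ≤ m → ∀ T : Set (ℝ × ℝ) → Prop,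
        (∀ r ∈ S, ∀ s ∈ S, b r ≤ b s → T r → T s) →
        (∀ r ∈ K, StabbedBy A r ∨ T r) → ∀ r ∈ S, StabbedBy A r ∨ T r := by
    intro A hA hAm T hT hK s hs
    by_cases hsK : s ∈ K
    · exact hK s hsK
    have : ∃ r ∈ K, ¬ StabbedBy A r := by
      by_contra hc
      push Not at hc
      exact hun ⟨A, hA, hAm, hc⟩
    obtain ⟨r, hr, hrA⟩ := this
    exact Or.inr (hT r (hKS hr) s hs (hpre r hr s hs hsK) ((hK r hr).resolve_left hrA))
  by_cases hqH : StabbedBy H q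
  · obtain ⟨l, hl, hlq⟩ := hqH
    refine ⟨K, hKS, insert l A₀, insert_subset hl hA₀, ?_, ?_, hfinal⟩
    · exact (Set.ncard_insert_le _ _).trans (by omega)
    · intro r hr _
      by_cases hrq : r = q
      · subst hrq
        exact ⟨l, mem_insert _ _, hlq⟩
      · exact (hA₀s r ⟨hr, hrq⟩).mono' (subset_insert _ _)
  · refine ⟨K, hKS, A₀, hA₀, by omega, ?_, hfinal⟩
    intro r hr hrH
    by_cases hrq : r = q
    · subst hrq
      exact absurd hrH hqH
    · exact hA₀s r ⟨hr, hrq⟩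

lemma component_side {V₀ : Set (Set (ℝ × ℝ))} {P : Set (ℝ × ℝ)} (hP : P ∈ components V₀)
    {x y z : ℝ} (hx : vline x ⊆ P) (hy : vline y ⊆ P) (hz : vline z ∈ V₀) :
    ¬ (x ≤ z ∧ z ≤ y) := by
  rintro ⟨h1, h2⟩
  obtain ⟨p, hp, rfl⟩ := hP
  have hc := (isPreconnected_connectedComponentIn (x := p) (F := (⋃ l ∈ V₀, l)ᶜ)).image
    Prod.fst continuous_fst.continuousOn
  have hz' := hc.ordConnected.out ⟨(x, 0), hx rfl, rfl⟩ ⟨(y, 0), hy rfl, rfl⟩ ⟨h1, h2⟩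
  obtain ⟨q, hq, hqz⟩ := hz'
  have := connectedComponentIn_subset _ _ hq
  exact this (mem_biUnion hz hqz)

lemma ncard_biUnion_le_mul (G : Set (Set (ℝ × ℝ))) (hG : G.Finite)
    (F : Set (ℝ × ℝ) → Set (Set (ℝ × ℝ))) (n : ℕ) (h : ∀ P ∈ G, (F P).ncard ≤ n) :
    (⋃ P ∈ G, F P).ncard ≤ G.ncard * n := by
  induction G, hG using Set.Finite.induction_on with
  | empty => simp
  | @insert a s ha hs ih =>
    rw [biUnion_insert, Set.ncard_insert_of_notMem ha hs]
    have h1 := Set.ncard_union_le (F a) (⋃ P ∈ s, F P)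
    have h2 := ih (fun P hP => h P (mem_insert_of_mem _ hP))
    have h3 := h a (mem_insert _ _)
    nlinarith

theorem stmt3 (R H V : Set (Set (ℝ × ℝ))) (k : ℕ)
    (H₁ V₀ Gv V₁ Hs : Set (Set (ℝ × ℝ)))
    (vsel : Set (ℝ × ℝ) → Set (ℝ × ℝ))
    (hRfin : R.Finite) (hRrect : ∀ r ∈ R, IsRect r)
    (hHfin : H.Finite) (hH : IsHLineSet H)
    (hVfin : V.Finite) (hV : IsVLineSet V)
    (hH₁ : H₁ ⊆ H) (hV₀ : V₀ ⊆ V)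
    (hstab0 : StabsAll (H₁ ∪ V₀) R)
    (hGv : Gv ⊆ components V₀) (hGvfin : Gv.Finite)
    (hV₁ : V₁ ⊆ V₀)
    (hsep : VSeparated Gv V₁)
    (hHs : Hs ⊆ H) (hHsk : Hs.ncard ≤ k)
    (hvsel : ∀ P ∈ Gv, (∃ x : ℝ, vsel P = vline x) ∧ vsel P ⊆ P)
    (hstab : StabsAll (H₁ ∪ V₁ ∪ Hs ∪ (vsel '' Gv)) R) :
    ∃ K ⊆ R, ∃ H₀ ⊆ H,
      H₀.ncard ≤ 2 * Gv.ncard * (2 * k + 1) + Hs.ncard ∧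
      (∀ A ⊆ H, A.ncard ≤ 2 * k → ∀ B ⊆ V, Structured B Gv →
        (StabsAll (H₁ ∪ V₁ ∪ A ∪ B) R ↔ StabsAll (H₁ ∪ V₁ ∪ A ∪ B) K)) ∧
      (∀ r ∈ K, StabbedBy H r → StabbedBy (H₁ ∪ V₁ ∪ H₀) r) := by
  choose! a b c d hab hcd hreq using hRrect
  have hsv : ∀ r ∈ R, ∀ x, Stabs (vline x) r ↔ a r ≤ x ∧ x ≤ b r := by
    intro r hr x
    conv_lhs => rw [hreq r hr]
    exact stabs_vline_rect (hcd r hr)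
  have hxsP : ∀ P ∈ Gv, vsel P ⊆ P := fun P hP => (hvsel P hP).2
  have hvsel1 : ∀ P ∈ Gv, ∃ x : ℝ, vsel P = vline x := fun P hP => (hvsel P hP).1
  choose! xs hxs using hvsel1
  -- a rectangle meeting two different strips is stabbed by V₁
  have hsame : ∀ r ∈ R, ¬ StabbedBy V₁ r → ∀ P ∈ Gv, ∀ P' ∈ Gv, ∀ x x', vline x ⊆ P →
      vline x' ⊆ P' → Stabs (vline x) r → Stabs (vline x') r → P = P' := by
    intro r hr hn P hP P' hP' x x' hx hx' hs hs'
    by_contra hne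
    obtain ⟨l, hl, z, rfl, h⟩ := hsep.1 P hP P' hP' hne
    rw [hsv r hr] at hs hs'
    refine hn ⟨_, hl, (hsv r hr z).2 ?_⟩
    rcases h with ⟨h1, h2⟩ | ⟨h1, h2⟩
    · have e1 := h1 (x, 0) (hx rfl)
      have e2 := h2 (x', 0) (hx' rfl)
      simp only at e1 e2
      constructor <;> linarith [hs.1, hs.2, hs'.1, hs'.2]
    · have e1 := h1 (x', 0) (hx' rfl)
      have e2 := h2 (x, 0) (hx rfl)
      simp only at e1 e2
      constructor <;> linarith [hs.1, hs.2, hs'.1, hs'.2]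
  have key : ∀ P ∈ Gv, ∃ K ⊆ {r ∈ R | ¬ StabbedBy (H₁ ∪ V₁) r}, ∃ H₀ ⊆ H,
      H₀.ncard ≤ 2 * (2 * k + 1) ∧
      (∀ r ∈ K, StabbedBy H r → StabbedBy H₀ r) ∧
      ∀ A ⊆ H, A.ncard ≤ 2 * k → ∀ B ⊆ V, Structured B Gv →
        (∀ r ∈ K, StabbedBy A r ∨ StabbedBy B r) →
        ∀ r ∈ R, ¬ StabbedBy (H₁ ∪ V₁) r → Stabs (vsel P) r →
          StabbedBy A r ∨ StabbedBy B r := by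
    intro P hP
    have hxP : vline (xs P) ⊆ P := by
      have := hxsP P hP
      rwa [hxs P hP] at this
    set SL := {r ∈ R | ¬ StabbedBy (H₁ ∪ V₁) r ∧ Stabs (vline (xs P)) r ∧
      ∃ z, vline z ∈ V₀ ∧ z < xs P ∧ a r ≤ z} with hSL
    set SR := {r ∈ R | ¬ StabbedBy (H₁ ∪ V₁) r ∧ Stabs (vline (xs P)) r ∧
      ∃ z, vline z ∈ V₀ ∧ xs P < z ∧ z ≤ b r} with hSR
    have hSLR : SL ⊆ R := fun r hr => hr.1
    have hSRR : SR ⊆ R := fun r hr => hr.1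
    obtain ⟨KL, hKL, HL, hHL, hHLc, hHLs, hLf⟩ :=
      prefix_lemma SL H (hRfin.subset hSLR) hHfin b (2 * k)
    obtain ⟨KR, hKR, HR, hHR, hHRc, hHRs, hRf⟩ :=
      prefix_lemma SR H (hRfin.subset hSRR) hHfin (fun r => - a r) (2 * k)
    refine ⟨KL ∪ KR, union_subset (hKL.trans fun r hr => ⟨hr.1, hr.2.1⟩)
      (hKR.trans fun r hr => ⟨hr.1, hr.2.1⟩), HL ∪ HR,
      union_subset hHL hHR, ?_, ?_, ?_⟩
    · exact (Set.ncard_union_le _ _).trans (by omega)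
    · rintro r (hr | hr) h
      · exact (hHLs r hr h).mono' subset_union_left
      · exact (hHRs r hr h).mono' subset_union_right
    intro A hA hAc B hB ⟨f, hf, hfl⟩ hK r hr hn hs
    rw [hxs P hP] at hs
    have hline : ∀ r ∈ R, ¬ StabbedBy (H₁ ∪ V₁) r → Stabs (vline (xs P)) r →
        StabbedBy B r → ∃ x, vline x ∈ B ∧ vline x ⊆ P ∧ a r ≤ x ∧ x ≤ b r := by
      rintro r hr hn hs ⟨l, hl, hlr⟩
      obtain ⟨x, rfl⟩ := hV l (hB hl)
      have hPP := hsame r hr (fun h => hn (h.mono' subset_union_right)) P hP (f (vline x))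
        (hf.mapsTo hl) (xs P) x hxP (hfl _ hl) hs hlr
      refine ⟨x, hl, ?_, (hsv r hr x).1 hlr⟩
      rw [hPP]
      exact hfl _ hl
    have hL := hLf A hA hAc (StabbedBy B) (by
      rintro r ⟨hr, hrn, hrs, -⟩ s ⟨hs, hsn, hss, z, hz, hzx, haz⟩ hrb hT
      obtain ⟨x, hxB, hxPx, h1, h2⟩ := hline r hr hrn hrs hT
      refine ⟨_, hxB, (hsv s hs x).2 ⟨?_, h2.trans hrb⟩⟩
      by_contra hc
      push Not at hc
      exact component_side (hGv hP) hxPx hxP hz ⟨by linarith, hzx.le⟩)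
      (fun r hr => hK r (Or.inl hr))
    have hR' := hRf A hA hAc (StabbedBy B) (by
      rintro r ⟨hr, hrn, hrs, -⟩ s ⟨hs, hsn, hss, z, hz, hzx, haz⟩ hrb hT
      obtain ⟨x, hxB, hxPx, h1, h2⟩ := hline r hr hrn hrs hT
      refine ⟨_, hxB, (hsv s hs x).2 ⟨by linarith, ?_⟩⟩
      by_contra hc
      push Not at hc
      exact component_side (hGv hP) hxP hxPx hz ⟨hzx.le, by linarith⟩)
      (fun r hr => hK r (Or.inr hr))
    rcases stabbedBy_union.1 (hstab0 r hr) with h | ⟨l, hl, hlr⟩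
    · exact absurd (h.mono' subset_union_left) hn
    obtain ⟨z, rfl⟩ := hV l (hV₀ hl)
    rw [hsv r hr] at hlr
    rcases lt_trichotomy z (xs P) with h | h | h
    · exact hL r ⟨hr, hn, hs, z, hl, h, hlr.1⟩
    · exact absurd ⟨h.ge, h.le⟩ (component_side (hGv hP) hxP hxP hl)
    · exact hR' r ⟨hr, hn, hs, z, hl, h, hlr.2⟩
  choose! KP hKP HP hHP hHPc hHPs hfin using key
  refine ⟨{r ∈ R | StabbedBy (H₁ ∪ V₁ ∪ Hs) r} ∪ ⋃ P ∈ Gv, KP P, ?_,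
    Hs ∪ ⋃ P ∈ Gv, HP P, ?_, ?_, ?_, ?_⟩
  · exact union_subset (fun r hr => hr.1) (iUnion₂_subset fun P hP r hr => (hKP P hP hr).1)
  · exact union_subset hHs (iUnion₂_subset hHP)
  · have h1 := Set.ncard_union_le Hs (⋃ P ∈ Gv, HP P)
    have h2 := ncard_biUnion_le_mul Gv hGvfin HP _ hHPc
    nlinarith
  · intro A hA hAc B hB hst
    constructor
    · intro h r hr
      refine h r ?_
      rcases hr with hr | hr
      · exact hr.1
      · exact by
          simp only [mem_iUnion] at hr
          obtain ⟨P, hP, hr⟩ := hr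
          exact (hKP P hP hr).1
    · intro h r hr
      by_cases h1 : StabbedBy (H₁ ∪ V₁) r
      · exact h1.mono' (subset_union_left.trans subset_union_left)
      rcases stabbedBy_union.1 (hstab r hr) with h2 | ⟨l, ⟨P, hP, rfl⟩, hlr⟩
      · exact h r (Or.inl ⟨hr, h2⟩)
      have h4 := hfin P hP A hA hAc B hB hst (by
        intro s hs
        have h5 := h s (Or.inr (mem_biUnion hP hs))
        rw [stabbedBy_union, stabbedBy_union] at h5
        rcases h5 with (h5 | h5) | h5
        · exact absurd h5 (hKP P hP hs).2
        · exact Or.inl h5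
        · exact Or.inr h5) r hr h1 hlr
      rw [stabbedBy_union, stabbedBy_union]
      tauto
  · rintro r (hr | hr) h
    · exact hr.2.mono' (union_subset_union_right _ subset_union_left)
    · simp only [mem_iUnion] at hr
      obtain ⟨P, hP, hr⟩ := hr
      refine (hHPs P hP r hr h).mono' ?_
      exact ((subset_biUnion_of_mem hP).trans subset_union_right).trans subset_union_right
end
end

section
/- Let i ∈ {1,…,k} and p₁, p₂, p₃, p₄ ∈ {1,…,r}. Let 𝓗 be a set of horizontal lines and 𝓥 a set of vertical lines such that the only line of 𝓥 contained in ζ_v^{2i−2} is ℓ_v^{2ir+p₁}, the only line of 𝓥 contained in ζ_v^{2i−1} is ℓ_v^{2ir+r+p₂}, the only line of 𝓗 contained in ζ_h^{2i−2} is ℓ_h^{2ir+p₃}, the only line of 𝓗 contained in ζ_h^{2i−1} is ℓ_h^{2ir+r+p₄}, and 𝓗 ∪ 𝓥 stabs each of the rectangles TL^{x,y}_a and BR^{x,y}_a for all x, y ∈ {2i−2, 2i−1} and all a ∈ {2,…,r}. Then p₁ = p₂ = p₃ = p₄. -/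
open Set MeasureTheory

noncomputable section

/-- The closed vertical strip `ζ_v^x = [2r+xr+1, 2r+xr+r] × ℝ`. -/
def zetaV (r x : ℕ) : Set (ℝ × ℝ) :=
  {p : ℝ × ℝ | 2*(r:ℝ) + (x:ℝ)*(r:ℝ) + 1 ≤ p.1 ∧ p.1 ≤ 2*(r:ℝ) + (x:ℝ)*(r:ℝ) + (r:ℝ)}

/-- The closed horizontal strip `ζ_h^x = ℝ × [2r+xr+1, 2r+xr+r]`. -/
def zetaH (r x : ℕ) : Set (ℝ × ℝ) :=
  {p : ℝ × ℝ | 2*(r:ℝ) + (x:ℝ)*(r:ℝ) + 1 ≤ p.2 ∧ p.2 ≤ 2*(r:ℝ) + (x:ℝ)*(r:ℝ) + (r:ℝ)}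

/-- The family `𝓡_F` of forcing rectangles. -/
def RF (k r : ℕ) : Set (Set (ℝ × ℝ)) :=
  {R | ∃ x : ℕ, x < 2*k ∧ ∃ q : ℤ, -(5*(k:ℤ)) ≤ q ∧ q ≤ -1 ∧
    (R = rect (2*(r:ℝ) + (x:ℝ)*(r:ℝ) + 1) (2*(r:ℝ) + (x:ℝ)*(r:ℝ) + (r:ℝ)) (q:ℝ) (q:ℝ) ∨
     R = rect (q:ℝ) (q:ℝ) (2*(r:ℝ) + (x:ℝ)*(r:ℝ) + 1) (2*(r:ℝ) + (x:ℝ)*(r:ℝ) + (r:ℝ)))}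

/-- The adjacency rectangle `A^{i,j}_{p,q}` (with real parameters `I = i`, `J = j`,
`P = p`, `Q = q`). -/
def Arect (r I J P Q : ℝ) : Set (ℝ × ℝ) :=
  rect (2*I*r + P + 1) (2*I*r + r + P - 1) (2*J*r + Q + 1) (2*J*r + r + Q - 1)

/-- The "top-left" equality rectangle `TL^{x,y}_a`. -/
def TLrect (r X Y A : ℝ) : Set (ℝ × ℝ) :=
  rect (2*r + X*r + 1) (2*r + X*r + A - 1) (2*r + Y*r + A) (2*r + Y*r + r)

/-- The "bottom-right" equality rectangle `BR^{x,y}_a`. -/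
def BRrect (r X Y A : ℝ) : Set (ℝ × ℝ) :=
  rect (2*r + X*r + A) (2*r + X*r + r) (2*r + Y*r + 1) (2*r + Y*r + A - 1)

/-- The family `𝓡_A` encoding non-adjacency; vertex `v^i_p` is `(i-1, p-1) : Fin k × Fin r`. -/
def RA (k r : ℕ) (G : SimpleGraph (Fin k × Fin r)) : Set (Set (ℝ × ℝ)) :=
  {R | ∃ i j : Fin k, i ≠ j ∧ ∃ p q : Fin r, ¬ G.Adj (i, p) (j, q) ∧
    R = Arect (r:ℝ) ((i:ℕ)+1 : ℝ) ((j:ℕ)+1 : ℝ) ((p:ℕ)+1 : ℝ) ((q:ℕ)+1 : ℝ)}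

/-- The family `𝓡_E` of equality rectangles. -/
def RE (k r : ℕ) : Set (Set (ℝ × ℝ)) :=
  {R | ∃ x y : ℕ, x < 2*k ∧ y < 2*k ∧ x / 2 = y / 2 ∧ ∃ a : ℕ, 2 ≤ a ∧ a ≤ r ∧
    (R = TLrect (r:ℝ) (x:ℝ) (y:ℝ) (a:ℝ) ∨ R = BRrect (r:ℝ) (x:ℝ) (y:ℝ) (a:ℝ))}

/-- A multicolored clique: a clique meeting each color class `{i} × Fin r` at most once. -/
def IsMulticoloredClique {k r : ℕ} (G : SimpleGraph (Fin k × Fin r))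
    (C : Finset (Fin k × Fin r)) : Prop :=
  G.IsClique (C : Set (Fin k × Fin r)) ∧
  ∀ u ∈ C, ∀ w ∈ C, u.1 = w.1 → u = w

lemma stab_cases {H V : Set (Set (ℝ × ℝ))} (hH : IsHLineSet H) (hV : IsVLineSet V)
    {a b c d : ℝ} (h : StabbedBy (H ∪ V) (rect a b c d)) :
    (∃ x, vline x ∈ V ∧ a ≤ x ∧ x ≤ b) ∨ (∃ y, hline y ∈ H ∧ c ≤ y ∧ y ≤ d) := by
  obtain ⟨l, hl, q, hq, hql⟩ := h
  obtain ⟨⟨h1, h2⟩, h3, h4⟩ := hq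
  rcases hl with hl | hl
  · obtain ⟨y, rfl⟩ := hH l hl
    have : q.2 = y := hql
    subst this
    exact Or.inr ⟨_, hl, h3, h4⟩
  · obtain ⟨y, rfl⟩ := hV l hl
    have : q.1 = y := hql
    subst this
    exact Or.inl ⟨_, hl, h1, h2⟩

lemma vuniq {V : Set (Set (ℝ × ℝ))} {r x : ℕ} {c z : ℝ}
    (hu : ∀ l ∈ V, l ⊆ zetaV r x → l = vline c) (hz : vline z ∈ V)
    (h1 : 2*(r:ℝ) + (x:ℝ)*(r:ℝ) + 1 ≤ z) (h2 : z ≤ 2*(r:ℝ) + (x:ℝ)*(r:ℝ) + (r:ℝ)) : z = c := by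
  have h := hu _ hz (by
    intro q hq
    have hq' : q.1 = z := hq
    exact ⟨by rw [hq']; exact h1, by rw [hq']; exact h2⟩)
  have : ((z, 0) : ℝ × ℝ) ∈ vline c := by rw [← h]; exact rfl
  exact this

lemma huniq {V : Set (Set (ℝ × ℝ))} {r x : ℕ} {c z : ℝ}
    (hu : ∀ l ∈ V, l ⊆ zetaH r x → l = hline c) (hz : hline z ∈ V)
    (h1 : 2*(r:ℝ) + (x:ℝ)*(r:ℝ) + 1 ≤ z) (h2 : z ≤ 2*(r:ℝ) + (x:ℝ)*(r:ℝ) + (r:ℝ)) : z = c := by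
  have h := hu _ hz (by
    intro q hq
    have hq' : q.2 = z := hq
    exact ⟨by rw [hq']; exact h1, by rw [hq']; exact h2⟩)
  have : ((0, z) : ℝ × ℝ) ∈ hline c := by rw [← h]; exact rfl
  exact this

lemma key {H V : Set (Set (ℝ × ℝ))} (hH : IsHLineSet H) (hV : IsVLineSet V)
    {r x y p q : ℕ} {c d : ℝ} (hp : 1 ≤ p ∧ p ≤ r) (hq : 1 ≤ q ∧ q ≤ r)
    (hc : c = 2*(r:ℝ) + (x:ℝ)*(r:ℝ) + p) (hd : d = 2*(r:ℝ) + (y:ℝ)*(r:ℝ) + q)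
    (hVu : ∀ l ∈ V, l ⊆ zetaV r x → l = vline c)
    (hHu : ∀ l ∈ H, l ⊆ zetaH r y → l = hline d)
    (hs : ∀ a : ℕ, 2 ≤ a → a ≤ r →
        StabbedBy (H ∪ V) (TLrect (r:ℝ) (x:ℝ) (y:ℝ) (a:ℝ)) ∧
        StabbedBy (H ∪ V) (BRrect (r:ℝ) (x:ℝ) (y:ℝ) (a:ℝ))) : p = q := by
  apply le_antisymm
  · by_contra! hlt
    have hpr : (p:ℝ) ≤ r := by exact_mod_cast hp.2
    have hp1 : (1:ℝ) ≤ p := by exact_mod_cast hp.1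
    have hlt' : (q:ℝ) < p := by exact_mod_cast hlt
    rcases stab_cases hH hV (hs p (by omega) hp.2).1 with ⟨z, hz, h1, h2⟩ | ⟨z, hz, h1, h2⟩
    · have := vuniq hVu hz h1 (by linarith)
      linarith
    · have := huniq hHu hz (by linarith) h2
      linarith
  · by_contra! hlt
    have hpr : (q:ℝ) ≤ r := by exact_mod_cast hq.2
    have hp1 : (1:ℝ) ≤ q := by exact_mod_cast hq.1
    have hlt' : (p:ℝ) < q := by exact_mod_cast hlt
    rcases stab_cases hH hV (hs q (by omega) hq.2).2 with ⟨z, hz, h1, h2⟩ | ⟨z, hz, h1, h2⟩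
    · have := vuniq hVu hz (by linarith) h2
      linarith
    · have := huniq hHu hz h1 (by linarith)
      linarith

theorem stmt11 (k r : ℕ) (hk : 1 ≤ k) (hr : 2 ≤ r)
    (i p₁ p₂ p₃ p₄ : ℕ) (hi : 1 ≤ i ∧ i ≤ k)
    (hp₁ : 1 ≤ p₁ ∧ p₁ ≤ r) (hp₂ : 1 ≤ p₂ ∧ p₂ ≤ r)
    (hp₃ : 1 ≤ p₃ ∧ p₃ ≤ r) (hp₄ : 1 ≤ p₄ ∧ p₄ ≤ r)
    (H V : Set (Set (ℝ × ℝ)))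
    (hH : IsHLineSet H) (hV : IsVLineSet V)
    (hV1mem : vline (2*(i:ℝ)*(r:ℝ) + (p₁:ℝ)) ∈ V)
    (hV1uniq : ∀ l ∈ V, l ⊆ zetaV r (2*i - 2) → l = vline (2*(i:ℝ)*(r:ℝ) + (p₁:ℝ)))
    (hV2mem : vline (2*(i:ℝ)*(r:ℝ) + (r:ℝ) + (p₂:ℝ)) ∈ V)
    (hV2uniq : ∀ l ∈ V, l ⊆ zetaV r (2*i - 1) → l = vline (2*(i:ℝ)*(r:ℝ) + (r:ℝ) + (p₂:ℝ)))
    (hH1mem : hline (2*(i:ℝ)*(r:ℝ) + (p₃:ℝ)) ∈ H)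
    (hH1uniq : ∀ l ∈ H, l ⊆ zetaH r (2*i - 2) → l = hline (2*(i:ℝ)*(r:ℝ) + (p₃:ℝ)))
    (hH2mem : hline (2*(i:ℝ)*(r:ℝ) + (r:ℝ) + (p₄:ℝ)) ∈ H)
    (hH2uniq : ∀ l ∈ H, l ⊆ zetaH r (2*i - 1) → l = hline (2*(i:ℝ)*(r:ℝ) + (r:ℝ) + (p₄:ℝ)))
    (hstab : ∀ x ∈ ({2*i - 2, 2*i - 1} : Set ℕ), ∀ y ∈ ({2*i - 2, 2*i - 1} : Set ℕ),
      ∀ a : ℕ, 2 ≤ a → a ≤ r →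
        StabbedBy (H ∪ V) (TLrect (r:ℝ) (x:ℝ) (y:ℝ) (a:ℝ)) ∧
        StabbedBy (H ∪ V) (BRrect (r:ℝ) (x:ℝ) (y:ℝ) (a:ℝ))) :
    p₁ = p₂ ∧ p₂ = p₃ ∧ p₃ = p₄ := by
  have e1 : ((2*i-2 : ℕ) : ℝ) = 2*i - 2 := by
    rw [Nat.cast_sub (by omega)]; push_cast; ring
  have e2 : ((2*i-1 : ℕ) : ℝ) = 2*i - 1 := by
    rw [Nat.cast_sub (by omega)]; push_cast; ring
  have m1 : 2*i-2 ∈ ({2*i - 2, 2*i - 1} : Set ℕ) := by simp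
  have m2 : 2*i-1 ∈ ({2*i - 2, 2*i - 1} : Set ℕ) := by simp
  have a := key hH hV hp₁ hp₃ (by rw [e1]; ring) (by rw [e1]; ring) hV1uniq hH1uniq
    (hstab _ m1 _ m1)
  have b := key hH hV hp₂ hp₃ (by rw [e2]; ring) (by rw [e1]; ring) hV2uniq hH1uniq
    (hstab _ m2 _ m1)
  have c := key hH hV hp₂ hp₄ (by rw [e2]; ring) (by rw [e2]; ring) hV2uniq hH2uniq
    (hstab _ m2 _ m2)
  omega
end
end
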